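/- Let V be a finite set with a symmetric, irreflexive neighborhood map N : V → 𝒫(V) (u ∈ N(v) ⟺ v ∈ N(u), and v ∉ N(v)), and let p : V × V → ℝ satisfy 0 ≤ p(u,v) ≤ 1 for all u, v. Define N(S) = (⋃_{u∈S} N(u)) \ S and EDV(S) = |S| + Σ_{v ∈ N(S)} (1 − ∏_{u ∈ S ∩ N(v)} (1 − p(u,v))). Then EDV is non-decreasing (for all S ⊆ T ⊆ V, EDV(S) ≤ EDV(T)) and submodular (for all S ⊆ T ⊆ V and w ∈ V, EDV(S ∪ {w}) − EDV(S) ≥ EDV(T ∪ {w}) − EDV(T)). -/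

import Mathlib

open Finset
open scoped Classical

/-- The one-hop neighborhood `N(S) = (⋃_{u∈S} N(u)) \ S` of a seed set. -/
noncomputable def nbhdSet {V : Type*} [Fintype V] (N : V → Finset V) (S : Finset V) :
    Finset V :=
  (S.biUnion N) \ S

/-- The expected diffusion value
`EDV(S) = |S| + Σ_{v ∈ N(S)} (1 − ∏_{u ∈ S ∩ N(v)} (1 − p(u,v)))`. -/
noncomputable def EDV {V : Type*} [Fintype V] (N : V → Finset V) (p : V × V → ℝ)
    (S : Finset V) : ℝ :=
  (S.card : ℝ) + ∑ v ∈ nbhdSet N S, (1 - ∏ u ∈ S ∩ N v, (1 - p (u, v)))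

/-- Probability that `u` fails to activate `v`, with `u` always activating itself. -/
noncomputable def failProb {V : Type*} (N : V → Finset V) (p : V × V → ℝ) (u v : V) : ℝ :=
  if u = v then 0 else if u ∈ N v then 1 - p (u, v) else 1

theorem EDV_eq_sum {V : Type*} [Fintype V] (N : V → Finset V)
    (hsymm : ∀ u v : V, u ∈ N v ↔ v ∈ N u) (p : V × V → ℝ) (S : Finset V) :
    EDV N p S = ∑ v : V, (1 - ∏ u ∈ S, failProb N p u v) := by
  have hcard : (S.card : ℝ) = ∑ v : V, (if v ∈ S then (1 : ℝ) else 0) := by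
    simp
  have hsum : ∑ v ∈ nbhdSet N S, (1 - ∏ u ∈ S ∩ N v, (1 - p (u, v)))
      = ∑ v : V, (if v ∈ nbhdSet N S then (1 - ∏ u ∈ S ∩ N v, (1 - p (u, v))) else 0) := by
    rw [Finset.sum_ite_mem, Finset.univ_inter]
  unfold EDV
  rw [hcard, hsum, ← Finset.sum_add_distrib]
  refine Finset.sum_congr rfl fun v _ => ?_
  by_cases hv : v ∈ S
  · have h0 : ∏ u ∈ S, failProb N p u v = 0 :=
      Finset.prod_eq_zero hv (by simp [failProb])
    have h1 : v ∉ nbhdSet N S := by simp [nbhdSet, hv]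
    simp [hv, h0, h1]
  · have h0 : ∏ u ∈ S, failProb N p u v = ∏ u ∈ S ∩ N v, (1 - p (u, v)) := by
      rw [← Finset.prod_ite_mem]
      refine Finset.prod_congr rfl fun u hu => ?_
      have : u ≠ v := fun h => hv (h ▸ hu)
      simp [failProb, this]
    by_cases h1 : v ∈ nbhdSet N S
    · simp [hv, h0, h1]
    · have h2 : S ∩ N v = ∅ := by
        ext u
        simp only [Finset.mem_inter, Finset.notMem_empty, iff_false]
        rintro ⟨hu, huv⟩
        apply h1
        simp only [nbhdSet, Finset.mem_sdiff, Finset.mem_biUnion]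
        exact ⟨⟨u, hu, (hsymm u v).1 huv⟩, hv⟩
      simp [hv, h0, h1, h2]

/-- For a symmetric, irreflexive neighborhood map and probabilities in `[0,1]`,
`EDV` is non-decreasing and submodular. -/
theorem EDV_monotone_submodular
    {V : Type*} [Fintype V] (N : V → Finset V)
    (hsymm : ∀ u v : V, u ∈ N v ↔ v ∈ N u)
    (hirrefl : ∀ v : V, v ∉ N v)
    (p : V × V → ℝ) (hp : ∀ u v : V, 0 ≤ p (u, v) ∧ p (u, v) ≤ 1) :
    (∀ S T : Finset V, S ⊆ T → EDV N p S ≤ EDV N p T) ∧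
    (∀ S T : Finset V, S ⊆ T → ∀ w : V,
      EDV N p (S ∪ {w}) - EDV N p S ≥ EDV N p (T ∪ {w}) - EDV N p T) := by
  have hq : ∀ u v, 0 ≤ failProb N p u v ∧ failProb N p u v ≤ 1 := by
    intro u v
    have := hp u v
    unfold failProb
    split_ifs <;> constructor <;> linarith
  have hanti : ∀ S T : Finset V, S ⊆ T → ∀ v,
      ∏ u ∈ T, failProb N p u v ≤ ∏ u ∈ S, failProb N p u v := by
    intro S T h v
    rw [← Finset.prod_sdiff h]
    exact mul_le_of_le_one_left (Finset.prod_nonneg fun u _ => (hq u v).1)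
      (Finset.prod_le_one (fun u _ => (hq u v).1) (fun u _ => (hq u v).2))
  have hmono : ∀ S T : Finset V, S ⊆ T → EDV N p S ≤ EDV N p T := by
    intro S T h
    rw [EDV_eq_sum N hsymm, EDV_eq_sum N hsymm]
    exact Finset.sum_le_sum fun v _ => sub_le_sub_left (hanti S T h v) 1
  refine ⟨hmono, fun S T h w => ?_⟩
  by_cases hw : w ∈ T
  · have h1 : T ∪ {w} = T := by simpa using hw
    rw [h1]
    have := hmono S (S ∪ {w}) Finset.subset_union_left
    linarith
  · have hwS : w ∉ S := fun h' => hw (h h')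
    simp only [EDV_eq_sum N hsymm, ← Finset.sum_sub_distrib, ge_iff_le]
    refine Finset.sum_le_sum fun v _ => ?_
    rw [Finset.union_comm T, Finset.union_comm S, ← Finset.insert_eq, ← Finset.insert_eq,
      Finset.prod_insert hw, Finset.prod_insert hwS]
    nlinarith [hanti S T h v, (hq w v).2]
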